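/- Let P ⊂ ℝⁿ be a bounded open convex polytope containing the origin and let K > 0. If (u_n) ⊂ 𝒞⋆^K(P) converges locally uniformly on P to a function u : P → ℝ, then u ∈ 𝒞⋆^K(P); that is, u is convex, inf_P u = u(0) = 0, and the radial boundary extension of u satisfies ∫_{∂P} u dσ₀ ≤ K. In particular, 𝒞⋆^K(P) is closed under local uniform convergence. -/

import Mathlib

open MeasureTheory Filter Set Metric
open scoped ENNReal RealInnerProductSpace Topology NNReal

noncomputable section

namespace ToricExtremal

/-- The open polytope `{x | ⟨l i, x⟩ < λ i for all i}` determined by a half-space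
presentation with normals `l` and constants `lam`. -/
def Poly {n : ℕ} {ι : Type*} [Fintype ι] (l : ι → EuclideanSpace ℝ (Fin n))
    (lam : ι → ℝ) : Set (EuclideanSpace ℝ (Fin n)) :=
  {x | ∀ i, ⟪l i, x⟫ < lam i}

/-- The inner polytope `P_δ`, whose facets are parallel to those of `P` at distance `δ`. -/
def PolyInner {n : ℕ} {ι : Type*} [Fintype ι] (l : ι → EuclideanSpace ℝ (Fin n))
    (lam : ι → ℝ) (δ : ℝ) : Set (EuclideanSpace ℝ (Fin n)) :=
  {x | ∀ i, ⟪l i, x⟫ < lam i - ‖l i‖ * δ}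

/-- The facet `F i = {x ∈ ∂P | ⟨l i, x⟩ = λ i}`. -/
def Facet {n : ℕ} {ι : Type*} [Fintype ι] (l : ι → EuclideanSpace ℝ (Fin n))
    (lam : ι → ℝ) (i : ι) : Set (EuclideanSpace ℝ (Fin n)) :=
  {x ∈ frontier (Poly l lam) | ⟪l i, x⟫ = lam i}

/-- `σ₀`: the `(n-1)`-dimensional Hausdorff measure on `ℝⁿ`. -/
def sigma0 (n : ℕ) : Measure (EuclideanSpace ℝ (Fin n)) := μH[(n : ℝ) - 1]

/-- The weighted boundary measure `σ`, equal to `|l i|⁻¹ σ₀` on the facet `F i`. -/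
def sigmaW {n : ℕ} {ι : Type*} [Fintype ι] (l : ι → EuclideanSpace ℝ (Fin n))
    (lam : ι → ℝ) : Measure (EuclideanSpace ℝ (Fin n)) :=
  ∑ i : ι, (ENNReal.ofReal (1 / ‖l i‖)) • ((sigma0 n).restrict (Facet l lam i))

/-- The Delzant condition: every normal `l i` is a primitive integral vector, and every
vertex (extreme point of the closure) lies on exactly `n` facets whose normals form a
`ℤ`-basis of `ℤⁿ` (equivalently, an integral matrix of determinant `±1`). -/
def IsDelzant {n : ℕ} {ι : Type*} [Fintype ι] (l : ι → EuclideanSpace ℝ (Fin n))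
    (lam : ι → ℝ) : Prop :=
  (∀ i j, ∃ m : ℤ, l i j = (m : ℝ)) ∧
  (∀ i, ∀ k : ℕ, 2 ≤ k → ¬ (∀ j, ∃ m : ℤ, l i j = (k : ℝ) * (m : ℝ))) ∧
  (∀ x ∈ Set.extremePoints ℝ (closure (Poly l lam)),
    ∃ e : Fin n ≃ {i : ι // ⟪l i, x⟫ = lam i},
      |(Matrix.of fun j k => l (e j).1 k).det| = 1)

/-- The second partial derivative `∂²u/∂xᵢ∂xⱼ` at `x`. -/
def secondPartial {n : ℕ} (u : EuclideanSpace ℝ (Fin n) → ℝ) (i j : Fin n)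
    (x : EuclideanSpace ℝ (Fin n)) : ℝ :=
  iteratedFDeriv ℝ 2 u x ![EuclideanSpace.single i 1, EuclideanSpace.single j 1]

/-- The (classical) Hessian matrix `D²u(x)`. -/
def hessianMatrix {n : ℕ} (u : EuclideanSpace ℝ (Fin n) → ℝ)
    (x : EuclideanSpace ℝ (Fin n)) : Matrix (Fin n) (Fin n) ℝ :=
  Matrix.of fun i j => secondPartial u i j x

/-- Guillemin's canonical potential `u_P(x) = Σᵢ (λᵢ − ⟨lᵢ,x⟩) log (λᵢ − ⟨lᵢ,x⟩)`. -/
def guillemin {n : ℕ} {ι : Type*} [Fintype ι] (l : ι → EuclideanSpace ℝ (Fin n))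
    (lam : ι → ℝ) (x : EuclideanSpace ℝ (Fin n)) : ℝ :=
  ∑ i : ι, (lam i - ⟪l i, x⟫) * Real.log (lam i - ⟪l i, x⟫)

/-- `(u_P)^{ij}_{ij}`: the double divergence `Σ_{i,j} ∂²((D²u_P)⁻¹)_{ij}/∂xᵢ∂xⱼ` of the
inverse Hessian of the Guillemin potential. -/
def divDivInvHessGuillemin {n : ℕ} {ι : Type*} [Fintype ι]
    (l : ι → EuclideanSpace ℝ (Fin n)) (lam : ι → ℝ) (x : EuclideanSpace ℝ (Fin n)) : ℝ :=
  ∑ i : Fin n, ∑ j : Fin n,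
    secondPartial (fun y => (hessianMatrix (guillemin l lam) y)⁻¹ i j) i j x

/-- `H` is an Alexandrov Hessian of `u` on `P`: a measurable matrix-valued map which is
a.e. positive semidefinite and gives the second-order Taylor expansion of `u` at a.e.
point of `P`. -/
def IsAlexHessian {n : ℕ} (P : Set (EuclideanSpace ℝ (Fin n)))
    (u : EuclideanSpace ℝ (Fin n) → ℝ)
    (H : EuclideanSpace ℝ (Fin n) → Matrix (Fin n) (Fin n) ℝ) : Prop :=
  (∀ i j, Measurable fun x => H x i j) ∧
  ∀ᵐ x ∂(volume.restrict P),
    (H x).PosSemidef ∧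
    ∃ g : EuclideanSpace ℝ (Fin n),
      Tendsto (fun y : EuclideanSpace ℝ (Fin n) =>
          (u y - u x - ⟪g, y - x⟫
            - (1 / 2) * ∑ i : Fin n, ∑ j : Fin n, H x i j * (y - x) i * (y - x) j)
          / ‖y - x‖ ^ 2)
        (𝓝[≠] x) (𝓝 0)

/-- The radial boundary extension `u(z) = lim_{t→1⁻} u (t • z)` (as a value in `[0,∞]`,
computed via `limsup` so as to be everywhere defined). -/
def radExt {n : ℕ} (u : EuclideanSpace ℝ (Fin n) → ℝ) (z : EuclideanSpace ℝ (Fin n)) : ℝ≥0∞ :=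
  Filter.limsup (fun t : ℝ => ENNReal.ofReal (u (t • z))) (𝓝[<] (1 : ℝ))

/-- The radial limits of `u` exist (in `[0,∞]`) at every boundary point of `P`. -/
def HasRadExt {n : ℕ} (P : Set (EuclideanSpace ℝ (Fin n)))
    (u : EuclideanSpace ℝ (Fin n) → ℝ) : Prop :=
  ∀ z ∈ frontier P,
    Tendsto (fun t : ℝ => ENNReal.ofReal (u (t • z))) (𝓝[<] (1 : ℝ)) (𝓝 (radExt u z))

/-- The class `𝒞⋆^K(P)`: nonnegative convex functions on `P`, vanishing at the origin,
whose radial boundary extension has `σ₀`-integral at most `K`. -/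
def MemCstar {n : ℕ} {ι : Type*} [Fintype ι] (l : ι → EuclideanSpace ℝ (Fin n))
    (lam : ι → ℝ) (K : ℝ) (u : EuclideanSpace ℝ (Fin n) → ℝ) : Prop :=
  ConvexOn ℝ (Poly l lam) u ∧ u 0 = 0 ∧ (∀ x ∈ Poly l lam, 0 ≤ u x) ∧
  HasRadExt (Poly l lam) u ∧
  ∫⁻ z in frontier (Poly l lam), radExt u z ∂(sigma0 n) ≤ ENNReal.ofReal K

/-- The class `𝒞`: convex functions of the form `u = u_P + v` with `v` smooth up to the
boundary of `P`. -/
def MemC {n : ℕ} {ι : Type*} [Fintype ι] (l : ι → EuclideanSpace ℝ (Fin n))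
    (lam : ι → ℝ) (u : EuclideanSpace ℝ (Fin n) → ℝ) : Prop :=
  ConvexOn ℝ (Poly l lam) u ∧
  ∃ v : EuclideanSpace ℝ (Fin n) → ℝ, ContDiffOn ℝ (⊤ : ℕ∞) v (closure (Poly l lam)) ∧
    ∀ x ∈ closure (Poly l lam), u x = guillemin l lam x + v x

/-- The normalized class `𝒞̃ = {u ∈ 𝒞 : inf_P u = u 0 = 0}`. -/
def MemCt {n : ℕ} {ι : Type*} [Fintype ι] (l : ι → EuclideanSpace ℝ (Fin n))
    (lam : ι → ℝ) (u : EuclideanSpace ℝ (Fin n) → ℝ) : Prop :=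
  MemC l lam u ∧ u 0 = 0 ∧ ∀ x ∈ Poly l lam, 0 ≤ u x

/-- `f` is an affine function on `ℝⁿ`. -/
def IsAffineFn {n : ℕ} (f : EuclideanSpace ℝ (Fin n) → ℝ) : Prop :=
  ∃ (g : EuclideanSpace ℝ (Fin n)) (c : ℝ), ∀ x, f x = ⟪g, x⟫ + c

/-- The (signed) integral `∫_S log (det H) dx`, with values in `EReal`: it is defined as
the difference of the integrals of the positive part `log⁺` and the negative part `log⁻`. -/
def logDetE {n : ℕ} (S : Set (EuclideanSpace ℝ (Fin n)))
    (H : EuclideanSpace ℝ (Fin n) → Matrix (Fin n) (Fin n) ℝ) : EReal :=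
  ((∫⁻ x in S, ENNReal.ofReal (Real.log (H x).det) : ℝ≥0∞) : EReal)
    - ((∫⁻ x in S, ENNReal.ofReal (-Real.log (H x).det) : ℝ≥0∞) : EReal)

/-- The Donaldson functional
`ℱ(u) = −∫_P log (det H) dx + ∫_{∂P} u dσ − ∫_P f ⬝ u dx`, valued in `EReal`, where `H` is
an Alexandrov Hessian of `u` and the boundary term uses the radial extension of `u`. -/
def Fcal {n : ℕ} {ι : Type*} [Fintype ι] (l : ι → EuclideanSpace ℝ (Fin n)) (lam : ι → ℝ)
    (f : EuclideanSpace ℝ (Fin n) → ℝ) (u : EuclideanSpace ℝ (Fin n) → ℝ)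
    (H : EuclideanSpace ℝ (Fin n) → Matrix (Fin n) (Fin n) ℝ) : EReal :=
  ((∫⁻ z, radExt u z ∂(sigmaW l lam) : ℝ≥0∞) : EReal)
    - ((∫ x in Poly l lam, f x * u x : ℝ) : EReal)
    - logDetE (Poly l lam) H

/-- The half-space presentation of the open rectangle `∏ (αᵢ, βᵢ)`: normals. -/
def rectL (n : ℕ) : (Fin n ⊕ Fin n) → EuclideanSpace ℝ (Fin n) :=
  Sum.elim (fun i => EuclideanSpace.single i 1) (fun i => -EuclideanSpace.single i 1)

/-- The half-space presentation of the open rectangle `∏ (αᵢ, βᵢ)`: constants. -/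
def rectLam {n : ℕ} (α β : Fin n → ℝ) : (Fin n ⊕ Fin n) → ℝ :=
  Sum.elim β (fun i => -α i)


/-- The functional `ℱ` on smooth elements of `𝒞̃` (real-valued):
`ℱ(u) = −∫_P log det D²u + ∫_{∂P} u dσ − ∫_P f ⬝ u dx`. -/
def FcalSmooth {n : ℕ} {ι : Type*} [Fintype ι] (l : ι → EuclideanSpace ℝ (Fin n))
    (lam : ι → ℝ) (f u : EuclideanSpace ℝ (Fin n) → ℝ) : ℝ :=
  -(∫ x in Poly l lam, Real.log ((hessianMatrix u x).det))
    + ((∫ z, u z ∂(sigmaW l lam)) - ∫ x in Poly l lam, f x * u x)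
theorem isOpen_poly {n : ℕ} {ι : Type*} [Fintype ι] (l : ι → EuclideanSpace ℝ (Fin n))
    (lam : ι → ℝ) : IsOpen (Poly l lam) := by
  simp only [Poly, Set.ofPred_forall]
  exact isOpen_iInter_of_finite fun i => isOpen_lt (by fun_prop) continuous_const

theorem inner_le_of_mem_closure_poly {n : ℕ} {ι : Type*} [Fintype ι]
    {l : ι → EuclideanSpace ℝ (Fin n)} {lam : ι → ℝ} {z : EuclideanSpace ℝ (Fin n)}
    (hz : z ∈ closure (Poly l lam)) (i : ι) : ⟪l i, z⟫ ≤ lam i :=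
  closure_minimal (t := {x | ⟪l i, x⟫ ≤ lam i}) (fun _ hx => (hx i).le)
    (isClosed_le (by fun_prop) continuous_const) hz

theorem smul_mem_poly_of_mem_closure {n : ℕ} {ι : Type*} [Fintype ι]
    {l : ι → EuclideanSpace ℝ (Fin n)} {lam : ι → ℝ} (hlam : ∀ i, 0 < lam i)
    {z : EuclideanSpace ℝ (Fin n)} (hz : z ∈ closure (Poly l lam)) {t : ℝ}
    (ht : t ∈ Ioo (0 : ℝ) 1) : t • z ∈ Poly l lam := by
  intro i
  rw [real_inner_smul_right]
  nlinarith [inner_le_of_mem_closure_poly hz i, hlam i, ht.1, ht.2]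

theorem monotoneOn_ofReal_smul {n : ℕ} {ι : Type*} [Fintype ι]
    {l : ι → EuclideanSpace ℝ (Fin n)} {lam : ι → ℝ} (hlam : ∀ i, 0 < lam i)
    {u : EuclideanSpace ℝ (Fin n) → ℝ} (hu : ConvexOn ℝ (Poly l lam) u) (hu0 : u 0 = 0)
    (hnn : ∀ x ∈ Poly l lam, 0 ≤ u x) {z : EuclideanSpace ℝ (Fin n)}
    (hz : z ∈ closure (Poly l lam)) :
    MonotoneOn (fun t : ℝ => ENNReal.ofReal (u (t • z))) (Ioo 0 1) := by
  intro s hs t ht hst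
  apply ENNReal.ofReal_le_ofReal
  have htz := smul_mem_poly_of_mem_closure hlam hz ht
  have h0 : (0 : EuclideanSpace ℝ (Fin n)) ∈ Poly l lam := fun i => by simpa using hlam i
  have hst1 : s / t ≤ 1 := (div_le_one ht.1).2 hst
  have h := hu.2 htz h0 (div_pos hs.1 ht.1).le (sub_nonneg.2 hst1) (by ring)
  rw [smul_zero, add_zero, smul_smul, div_mul_cancel₀ _ ht.1.ne', hu0, smul_zero, add_zero,
    smul_eq_mul] at h
  exact h.trans (mul_le_of_le_one_left (hnn _ htz) hst1)

theorem tendsto_radExt {n : ℕ} {u : EuclideanSpace ℝ (Fin n) → ℝ} {z : EuclideanSpace ℝ (Fin n)}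
    (h : MonotoneOn (fun t : ℝ => ENNReal.ofReal (u (t • z))) (Ioo 0 1)) :
    Tendsto (fun t : ℝ => ENNReal.ofReal (u (t • z))) (𝓝[<] 1) (𝓝 (radExt u z)) := by
  have hlim := h.tendsto_nhdsWithin_Ioo_left (nonempty_Ioo.2 one_pos) (OrderTop.bddAbove _)
  rw [radExt, hlim.limsup_eq]
  exact hlim

theorem ofReal_smul_le_radExt {n : ℕ} {u : EuclideanSpace ℝ (Fin n) → ℝ}
    {z : EuclideanSpace ℝ (Fin n)}
    (h : MonotoneOn (fun t : ℝ => ENNReal.ofReal (u (t • z))) (Ioo 0 1))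
    {t : ℝ} (ht : t ∈ Ioo (0 : ℝ) 1) : ENNReal.ofReal (u (t • z)) ≤ radExt u z := by
  refine ge_of_tendsto (tendsto_radExt h) ?_
  filter_upwards [Ioo_mem_nhdsLT ht.2] with s hs
  exact h ht ⟨ht.1.trans hs.1, hs.2⟩ hs.1.le

theorem aemeasurable_ofReal_smul {n : ℕ} {ι : Type*} [Fintype ι]
    {l : ι → EuclideanSpace ℝ (Fin n)} {lam : ι → ℝ} (hlam : ∀ i, 0 < lam i)
    {u : EuclideanSpace ℝ (Fin n) → ℝ} (hu : ConvexOn ℝ (Poly l lam) u) {t : ℝ}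
    (ht : t ∈ Ioo (0 : ℝ) 1) (μ : Measure (EuclideanSpace ℝ (Fin n))) :
    AEMeasurable (fun z => ENNReal.ofReal (u (t • z))) (μ.restrict (frontier (Poly l lam))) := by
  have hc : ContinuousOn (fun z => u (t • z)) (frontier (Poly l lam)) :=
    (hu.continuousOn (isOpen_poly l lam)).comp (by fun_prop) fun z hz =>
      smul_mem_poly_of_mem_closure hlam (frontier_subset_closure hz) ht
  exact (hc.aemeasurable isClosed_frontier.measurableSet).ennreal_ofReal

theorem convexOn_of_tendsto {E : Type*} [AddCommGroup E] [Module ℝ E] {s : Set E}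
    {f : ℕ → E → ℝ} {g : E → ℝ} (hf : ∀ m, ConvexOn ℝ s (f m))
    (h : ∀ x ∈ s, Tendsto (fun m => f m x) atTop (𝓝 (g x))) : ConvexOn ℝ s g := by
  refine ⟨(hf 0).1, fun x hx y hy a b ha hb hab => ?_⟩
  exact le_of_tendsto_of_tendsto' (h _ ((hf 0).1 hx hy ha hb hab))
    (((h x hx).const_smul a).add ((h y hy).const_smul b)) fun m => (hf m).2 hx hy ha hb hab

/-- the class `𝒞⋆^K(P)` is closed under local uniform convergence. -/
theorem MemCstar_closed_under_locally_uniform_limit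
    (n d : ℕ) (hn : 1 ≤ n) (l : Fin d → EuclideanSpace ℝ (Fin n)) (lam : Fin d → ℝ)
    (hl : ∀ i, l i ≠ 0) (hlam : ∀ i, 0 < lam i)
    (hbd : Bornology.IsBounded (Poly l lam))
    (K : ℝ) (hK : 0 < K)
    (useq : ℕ → EuclideanSpace ℝ (Fin n) → ℝ) (u : EuclideanSpace ℝ (Fin n) → ℝ)
    (hmem : ∀ m, MemCstar l lam K (useq m))
    (hconv : TendstoLocallyUniformlyOn useq u atTop (Poly l lam)) :
    MemCstar l lam K u := by
  have hpt : ∀ x ∈ Poly l lam, Tendsto (fun m => useq m x) atTop (𝓝 (u x)) := fun x hx =>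
    hconv.tendsto_at hx
  have h0 : (0 : EuclideanSpace ℝ (Fin n)) ∈ Poly l lam := fun i => by simpa using hlam i
  have hu : ConvexOn ℝ (Poly l lam) u := convexOn_of_tendsto (fun m => (hmem m).1) hpt
  have hu0 : u 0 = 0 :=
    tendsto_nhds_unique (hpt 0 h0) (by simp [fun m => (hmem m).2.1])
  have hnn : ∀ x ∈ Poly l lam, 0 ≤ u x := fun x hx =>
    ge_of_tendsto' (hpt x hx) fun m => (hmem m).2.2.1 x hx
  have hrad : HasRadExt (Poly l lam) u := fun z hz =>
    tendsto_radExt (monotoneOn_ofReal_smul hlam hu hu0 hnn (frontier_subset_closure hz))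
  refine ⟨hu, hu0, hnn, hrad, ?_⟩
  have hF : MeasurableSet (frontier (Poly l lam)) := isClosed_frontier.measurableSet
  have hbound : ∀ t ∈ Ioo (0 : ℝ) 1,
      ∫⁻ z in frontier (Poly l lam), ENNReal.ofReal (u (t • z)) ∂(sigma0 n)
        ≤ ENNReal.ofReal K := by
    intro t ht
    calc ∫⁻ z in frontier (Poly l lam), ENNReal.ofReal (u (t • z)) ∂(sigma0 n)
        = ∫⁻ z in frontier (Poly l lam),
            liminf (fun m => ENNReal.ofReal (useq m (t • z))) atTop ∂(sigma0 n) :=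
          setLIntegral_congr_fun hF fun z hz => (ENNReal.tendsto_ofReal
            (hpt _ (smul_mem_poly_of_mem_closure hlam
              (frontier_subset_closure hz) ht))).liminf_eq.symm
      _ ≤ liminf (fun m => ∫⁻ z in frontier (Poly l lam),
            ENNReal.ofReal (useq m (t • z)) ∂(sigma0 n)) atTop :=
          lintegral_liminf_le' fun m => aemeasurable_ofReal_smul hlam (hmem m).1 ht _
      _ ≤ ENNReal.ofReal K := by
          refine liminf_le_of_le (by isBoundedDefault) fun b hb => ?_
          obtain ⟨m, hm⟩ := hb.exists
          obtain ⟨hc, hz0, hpos, -, hint⟩ := hmem m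
          exact (hm.trans (setLIntegral_mono' hF fun z hz => ofReal_smul_le_radExt
            (monotoneOn_ofReal_smul hlam hc hz0 hpos (frontier_subset_closure hz)) ht)).trans hint
  obtain ⟨t, -, ht, htlim⟩ := exists_seq_strictMono_tendsto' (zero_lt_one (α := ℝ))
  have htlim' : Tendsto t atTop (𝓝[<] 1) :=
    tendsto_nhdsWithin_iff.2 ⟨htlim, Eventually.of_forall fun k => (ht k).2⟩
  calc ∫⁻ z in frontier (Poly l lam), radExt u z ∂(sigma0 n)
      = ∫⁻ z in frontier (Poly l lam),
          liminf (fun k => ENNReal.ofReal (u (t k • z))) atTop ∂(sigma0 n) :=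
        setLIntegral_congr_fun hF fun z hz => ((hrad z hz).comp htlim').liminf_eq.symm
    _ ≤ liminf (fun k => ∫⁻ z in frontier (Poly l lam),
          ENNReal.ofReal (u (t k • z)) ∂(sigma0 n)) atTop :=
        lintegral_liminf_le' fun k => aemeasurable_ofReal_smul hlam hu (ht k) _
    _ ≤ ENNReal.ofReal K :=
        liminf_le_of_le (by isBoundedDefault) fun b hb =>
          let ⟨k, hk⟩ := hb.exists
          hk.trans (hbound _ (ht k))

end ToricExtremal
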